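/- arXiv:2512.16807 — 3 statements merged into one kernel-verified Lean document; each statement's English description precedes it below -/
import Mathlib

section
/- Let G be a simple graph on a finite vertex set V and let k ≥ 1. If G is k-colorable, then for every function γ : V → ℤ there exists a proper coloring c : V → ℤ of G such that γ(v) ≤ c(v) ≤ γ(v) + k − 1 for every vertex v. In other words, every k-colorable graph admits a proper coloring from every assignment of interval lists of k consecutive integers to its vertices (it is k-(γ,μ)-choosable). -/
/-- Every `k`-colorable graph is `k`-(γ,μ)-choosable: for every assignment of interval
lists of `k` consecutive integers to the vertices, there is a proper coloring choosing
a color from each vertex's interval. -/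
theorem kColorable_implies_kGammaMuChoosable
    {V : Type*} [Fintype V] (G : SimpleGraph V) (k : ℕ) (hk : 1 ≤ k)
    (hcol : G.Colorable k) :
    ∀ γ : V → ℤ, ∃ c : V → ℤ,
      (∀ u v, G.Adj u v → c u ≠ c v) ∧
      (∀ v, γ v ≤ c v ∧ c v ≤ γ v + k - 1) := by
  intro γ
  obtain ⟨f⟩ := hcol
  have hk0 : (0 : ℤ) < k := by exact_mod_cast hk
  refine ⟨fun v => γ v + (((f v : ℕ) : ℤ) - γ v) % k, ?_, ?_⟩
  · intro u v huv h
    have key : ∀ w, (γ w + (((f w : ℕ) : ℤ) - γ w) % k) % k = ((f w : ℕ) : ℤ) := by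
      intro w
      rw [Int.add_emod_emod, add_sub_cancel]
      exact Int.emod_eq_of_lt (by positivity) (by exact_mod_cast (f w).isLt)
    have h2 : ((f u : ℕ) : ℤ) = ((f v : ℕ) : ℤ) := by
      rw [← key u, ← key v]
      exact congrArg (· % (k : ℤ)) h
    exact f.valid huv (Fin.ext (by exact_mod_cast h2))
  · intro v
    have h1 := Int.emod_nonneg (((f v : ℕ) : ℤ) - γ v) hk0.ne'
    have h2 := Int.emod_lt_of_pos (((f v : ℕ) : ℤ) - γ v) hk0
    constructor <;> dsimp only <;> linarith [Int.add_one_le_iff.mpr h2]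
end

section
/- Let G be a simple graph on a finite vertex set V, let k ≥ 1, let c₀ : V → ℕ be a proper coloring of G with c₀(v) < k for all v, and let γ : V → ℤ. Define f : V → ℤ by f(v) = γ(v) + ((c₀(v) − γ(v)) mod k), where mod denotes the nonnegative remainder of integer division by k. Then f is a proper coloring of G and γ(v) ≤ f(v) ≤ γ(v) + k − 1 for every vertex v. -/
/-- The explicit construction converting a proper `k`-coloring `c₀` into a proper
coloring from interval lists: `f v = γ v + ((c₀ v - γ v) mod k)` is a proper coloring
with `γ v ≤ f v ≤ γ v + k - 1` for every vertex. -/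
theorem interval_coloring_construction
    {V : Type*} [Fintype V] (G : SimpleGraph V) (k : ℕ) (hk : 1 ≤ k)
    (c₀ : V → ℕ) (hproper : ∀ u v, G.Adj u v → c₀ u ≠ c₀ v)
    (hlt : ∀ v, c₀ v < k) (γ : V → ℤ) :
    (∀ u v, G.Adj u v →
        γ u + ((c₀ u : ℤ) - γ u) % (k : ℤ) ≠ γ v + ((c₀ v : ℤ) - γ v) % (k : ℤ)) ∧
    (∀ v, γ v ≤ γ v + ((c₀ v : ℤ) - γ v) % (k : ℤ) ∧
        γ v + ((c₀ v : ℤ) - γ v) % (k : ℤ) ≤ γ v + k - 1) := by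
  have hk0 : (0 : ℤ) < (k : ℤ) := by exact_mod_cast hk
  have key : ∀ v, (γ v + ((c₀ v : ℤ) - γ v) % (k : ℤ)) % (k : ℤ) = (c₀ v : ℤ) := by
    intro v
    have h1 : (c₀ v : ℤ) < k := by exact_mod_cast hlt v
    rw [Int.add_emod_emod, add_sub_cancel]
    exact Int.emod_eq_of_lt (by positivity) h1
  refine ⟨fun u v huv h => hproper u v huv ?_, fun v => ?_⟩
  · have h2 := key u
    rw [h, key v] at h2
    exact_mod_cast h2.symm
  · have h1 := Int.emod_nonneg ((c₀ v : ℤ) - γ v) hk0.ne'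
    have h2 := Int.emod_lt_of_pos ((c₀ v : ℤ) - γ v) hk0
    constructor <;> linarith [Int.add_one_le_iff.mpr h2]
end

section
/- Let G be a simple graph on a finite vertex set V and let k ≥ 1. Then G is k-(γ,μ)-choosable if and only if G is k-colorable; that is, the following are equivalent: (1) for every function γ : V → ℤ there exists a proper coloring c of G with γ(v) ≤ c(v) ≤ γ(v) + k − 1 for every vertex v; (2) G admits a proper coloring with at most k colors. In particular, the (γ,μ)-choosability number χ_{ℓ,(γ,μ)}(G) equals the chromatic number χ(G). -/
/-- A graph is `k`-(γ,μ)-choosable iff it is `k`-colorable: it admits a proper coloring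
from every assignment of interval lists of `k` consecutive integers iff it admits a
proper coloring with at most `k` colors. -/
theorem kGammaMuChoosable_iff_kColorable
    {V : Type*} [Fintype V] (G : SimpleGraph V) (k : ℕ) (hk : 1 ≤ k) :
    (∀ γ : V → ℤ, ∃ c : V → ℤ,
        (∀ u v, G.Adj u v → c u ≠ c v) ∧
        (∀ v, γ v ≤ c v ∧ c v ≤ γ v + k - 1)) ↔
    G.Colorable k := by
  constructor
  · intro h
    obtain ⟨c, hc, hb⟩ := h (fun _ => 0)
    refine ⟨SimpleGraph.Coloring.mk (fun v => (⟨(c v).toNat, ?_⟩ : Fin k)) ?_⟩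
    · have := hb v
      omega
    · intro u v huv heq
      have h1 := hb u
      have h2 := hb v
      have h3 := hc u v huv
      simp only [Fin.mk.injEq] at heq h1 h2
      omega
  · rintro ⟨f⟩ γ
    have hk0 : (0 : ℤ) < k := by omega
    -- choose the representative of the residue class of `f v` lying in the interval at `v`
    refine ⟨fun v => γ v + (((f v : ℕ) : ℤ) - γ v) % k, ?_, ?_⟩
    · intro u v huv heq
      have hmod : ∀ w, (γ w + (((f w : ℕ) : ℤ) - γ w) % k) % k = ((f w : ℕ) : ℤ) := by
        intro w
        rw [Int.add_emod_emod, add_sub_cancel]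
        exact Int.emod_eq_of_lt (by omega) (by have := (f w).isLt; omega)
      have h1 := hmod u
      have h2 := hmod v
      simp only at heq
      rw [heq, h2] at h1
      apply f.valid huv
      apply Fin.ext
      omega
    · intro v
      have h1 := Int.emod_nonneg (((f v : ℕ) : ℤ) - γ v) hk0.ne'
      have h2 := Int.emod_lt_of_pos (((f v : ℕ) : ℤ) - γ v) hk0
      constructor
      · simp only
        linarith
      · simp only
        linarith [Int.add_one_le_iff.mpr h2]
end
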